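/- Let 0 < j < j_m with k_m(j) = j_m − j, and let k = k_m(j) ≥ 1. If α ≥ 1 and β ∈ ℝ satisfy χ_{jk}(α,β) ≠ 0 and β² > 1, then M^{2j_m} ≤ α ≤ 16·M^{8j} and (4M³)^{−1}·M^{8j/3}·α^{−1/3} ≤ β² ≤ 4·M^{8j/3}·α^{−1/3}. -/

import Mathlib

open MeasureTheory Filter Set

noncomputable section

/-- The temperature scale `j_m = 1 + ⌊log(1/T)/log M⌋`. -/
def jmax (M T : ℝ) : ℕ := 1 + ⌊Real.log (1 / T) / Real.log M⌋₊

/-- The maximal auxiliary scale `k_m(j) = min(j_m − j, 3j)`. -/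
def kmax (M T : ℝ) (j : ℕ) : ℕ := min (jmax M T - j) (3 * j)

/-- `X_{αβ} = (1+β²)^{3/4}·(α+β²)^{1/4}`. -/
def Xab (α β : ℝ) : ℝ := (1 + β ^ 2) ^ ((3:ℝ)/4) * (α + β ^ 2) ^ ((1:ℝ)/4)

/-- The main slice cutoff `χ_j`: `χ_0(X) = u(X)`;
`χ_j(X) = u(X/M^{2j}) − u(X/M^{2j−2})` for `0 < j < j_m`;
`χ_{j_m}(X) = 1 − u(X/M^{2j_m−2})`. -/
def chiMain (u : ℝ → ℝ) (M : ℝ) (jm j : ℕ) (X : ℝ) : ℝ :=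
  if j = 0 then u X
  else if j = jm then 1 - u (X / M ^ (2 * jm - 2))
  else u (X / M ^ (2 * j)) - u (X / M ^ (2 * j - 2))

/-- The auxiliary slice cutoff `χ̃_k` (at main scale `j`): if `k_m(j) = 0` then `χ̃_0 ≡ 1`;
otherwise `χ̃_0(α) = u(α/M^{2j})`, `χ̃_k(α) = u(α/M^{2j+2k}) − u(α/M^{2j+2k−2})` for
`0 < k < k_m(j)` and `χ̃_{k_m(j)}(α) = 1 − u(α/M^{2j+2k_m(j)})`. -/
def chiAux (u : ℝ → ℝ) (M T : ℝ) (j k : ℕ) (α : ℝ) : ℝ :=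
  if kmax M T j = 0 then 1
  else if k = 0 then u (α / M ^ (2 * j))
  else if k = kmax M T j then 1 - u (α / M ^ (2 * j + 2 * kmax M T j))
  else u (α / M ^ (2 * j + 2 * k)) - u (α / M ^ (2 * j + 2 * k - 2))

/-- `χ_{jk}(α,β) = χ_j(X_{αβ})·χ̃_k(α)`. -/
def chiJK (u : ℝ → ℝ) (M T : ℝ) (j k : ℕ) (α β : ℝ) : ℝ :=
  chiMain u M (jmax M T) j (Xab α β) * chiAux u M T j k α

/-- A difference of a cutoff at two scales vanishes unless `x` lies between them. -/
theorem mem_Ioo_of_cutoff_sub_ne_zero {u : ℝ → ℝ} (hu1 : ∀ x : ℝ, x ≤ 1 → u x = 1)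
    (hu2 : ∀ x : ℝ, 2 ≤ x → u x = 0) {a b x : ℝ} (ha : 0 < a) (hb : 0 < b) (hab : a ≤ b)
    (h : u (x / b) - u (x / a) ≠ 0) : x ∈ Ioo a (2 * b) := by
  constructor
  · by_contra! hx
    apply h
    rw [hu1 _ ((div_le_one hb).2 (hx.trans hab)), hu1 _ ((div_le_one ha).2 hx), sub_self]
  · by_contra! hx
    apply h
    rw [hu2 _ ((le_div_iff₀ hb).2 hx), hu2 _ ((le_div_iff₀ ha).2 (by linarith)), sub_self]

theorem Xab_nonneg {α : ℝ} (hα : 0 ≤ α) (β : ℝ) : 0 ≤ Xab α β := by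
  unfold Xab; positivity

theorem Xab_pow_four {α : ℝ} (hα : 0 ≤ α) (β : ℝ) :
    Xab α β ^ 4 = (1 + β ^ 2) ^ 3 * (α + β ^ 2) := by
  have h1 : (0 : ℝ) ≤ 1 + β ^ 2 := by positivity
  have h2 : (0 : ℝ) ≤ α + β ^ 2 := by positivity
  rw [Xab, mul_pow, ← Real.rpow_mul_natCast h1, ← Real.rpow_mul_natCast h2,
    show (3 : ℝ) / 4 * (4 : ℕ) = (3 : ℕ) by norm_num,
    show (1 : ℝ) / 4 * (4 : ℕ) = 1 by norm_num, Real.rpow_natCast, Real.rpow_one]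

theorem rpow_mul_rpow_pow_three {M α : ℝ} (hM : 0 ≤ M) (hα : 0 ≤ α) (j : ℕ) :
    (M ^ (8 * (j : ℝ) / 3) * α ^ (-(1 : ℝ) / 3)) ^ 3 = M ^ (8 * j) / α := by
  rw [mul_pow, ← Real.rpow_mul_natCast hM, ← Real.rpow_mul_natCast hα,
    show 8 * (j : ℝ) / 3 * (3 : ℕ) = (8 * j : ℕ) by push_cast; ring,
    show -(1 : ℝ) / 3 * (3 : ℕ) = -1 by norm_num, Real.rpow_natCast, Real.rpow_neg_one,
    div_eq_mul_inv]

/-- let `0 < j < j_m` with `k_m(j) = j_m − j` and `k = k_m(j) ≥ 1`.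
If `α ≥ 1`, `β ∈ ℝ`, `χ_{jk}(α,β) ≠ 0` and `β² > 1`, then
`M^{2j_m} ≤ α ≤ 16·M^{8j}` and `(4M³)^{−1}·M^{8j/3}·α^{−1/3} ≤ β² ≤ 4·M^{8j/3}·α^{−1/3}`. -/
theorem slicing_support_last_aux_scale (M T : ℝ) (hM : 2 ≤ M) (hT0 : 0 < T) (hT1 : T ≤ 1)
    (u : ℝ → ℝ) (hu01 : ∀ x, 0 ≤ u x ∧ u x ≤ 1)
    (hu1 : ∀ x : ℝ, x ≤ 1 → u x = 1) (hu2 : ∀ x : ℝ, 2 ≤ x → u x = 0)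
    (j : ℕ) (hj0 : 0 < j) (hjm : j < jmax M T)
    (hkm : kmax M T j = jmax M T - j) (hkm1 : 1 ≤ kmax M T j)
    (α β : ℝ) (hα : 1 ≤ α) (hchi : chiJK u M T j (kmax M T j) α β ≠ 0) (hβ : 1 < β ^ 2) :
    (M ^ (2 * jmax M T) ≤ α ∧ α ≤ 16 * M ^ (8 * j)) ∧
    ((4 * M ^ 3)⁻¹ * M ^ (8 * (j : ℝ) / 3) * α ^ (-(1:ℝ)/3) ≤ β ^ 2 ∧
      β ^ 2 ≤ 4 * M ^ (8 * (j : ℝ) / 3) * α ^ (-(1:ℝ)/3)) := by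
  have hM0 : 0 < M := by linarith
  have hM1 : 1 ≤ M := by linarith
  have hα0 : 0 < α := by linarith
  obtain ⟨hmain, haux⟩ := mul_ne_zero_iff.1 hchi
  rw [chiMain, if_neg hj0.ne', if_neg hjm.ne] at hmain
  rw [chiAux, if_neg (by lia), if_neg (by lia), if_pos rfl,
    show 2 * j + 2 * kmax M T j = 2 * jmax M T by lia] at haux
  have hαlow : M ^ (2 * jmax M T) < α := by
    by_contra! hx
    exact haux (by rw [hu1 _ ((div_le_one (by positivity)).2 hx), sub_self])
  obtain ⟨hXlow, hXup⟩ := mem_Ioo_of_cutoff_sub_ne_zero hu1 hu2 (by positivity) (by positivity)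
    (pow_le_pow_right₀ hM1 (Nat.sub_le _ _)) hmain
  have hX4 := Xab_pow_four hα0.le β
  have hc3 := rpow_mul_rpow_pow_three hM0.le hα0.le j
  have hup : Xab α β ^ 4 ≤ 16 * M ^ (8 * j) := by
    calc Xab α β ^ 4 ≤ (2 * M ^ (2 * j)) ^ 4 :=
          pow_le_pow_left₀ (Xab_nonneg hα0.le β) hXup.le 4
      _ = 16 * M ^ (8 * j) := by rw [mul_pow, ← pow_mul]; norm_num; congr 1; lia
  have hlow : M ^ (8 * j) ≤ M ^ 8 * Xab α β ^ 4 := by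
    calc M ^ (8 * j) = M ^ 8 * (M ^ (2 * j - 2)) ^ 4 := by
          rw [← pow_mul, ← pow_add]; congr 1; lia
      _ ≤ M ^ 8 * Xab α β ^ 4 := by gcongr
  have hM2j : 2 * M ^ (2 * j) ≤ α := by
    calc 2 * M ^ (2 * j) ≤ M * M ^ (2 * j) := by gcongr
      _ = M ^ (2 * j + 1) := by ring
      _ ≤ M ^ (2 * jmax M T) := pow_le_pow_right₀ hM1 (by lia)
      _ ≤ α := hαlow.le
  have hc0 : 0 < M ^ (8 * (j : ℝ) / 3) * α ^ (-(1 : ℝ) / 3) := by positivity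
  rw [mul_assoc, mul_assoc]
  generalize M ^ (8 * (j : ℝ) / 3) * α ^ (-(1 : ℝ) / 3) = c at hc3 hc0 ⊢
  generalize β ^ 2 = b at hβ hX4 ⊢
  have hb0 : 0 < b := by linarith
  have hbα : b ≤ α := by
    refine le_of_pow_le_pow_left₀ four_ne_zero hα0.le ?_
    calc b ^ 4 = b ^ 3 * b := by ring
      _ ≤ (1 + b) ^ 3 * (α + b) := by gcongr <;> linarith
      _ = Xab α β ^ 4 := hX4.symm
      _ ≤ α ^ 4 := pow_le_pow_left₀ (Xab_nonneg hα0.le β) (hXup.le.trans hM2j) 4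
  rw [hX4] at hup hlow
  rw [eq_div_iff hα0.ne'] at hc3
  refine ⟨⟨hαlow.le, ?_⟩, ?_, ?_⟩
  · refine le_trans ?_ hup
    have h1 : 1 ≤ (1 + b) ^ 3 := one_le_pow₀ (by linarith)
    nlinarith
  · rw [inv_mul_le_iff₀ (by positivity)]
    refine le_of_pow_le_pow_left₀ three_ne_zero (by positivity) (le_of_mul_le_mul_right ?_ hα0)
    calc c ^ 3 * α = M ^ (8 * j) := hc3
      _ ≤ M ^ 8 * ((1 + b) ^ 3 * (α + b)) := hlow
      _ ≤ M ^ 8 * ((b + b) ^ 3 * (α + α)) := by gcongr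
      _ = 16 * M ^ 8 * b ^ 3 * α := by ring
      _ ≤ 64 * M ^ 9 * b ^ 3 * α := by
          gcongr
          · norm_num
          · norm_num
      _ = (4 * M ^ 3 * b) ^ 3 * α := by ring
  · refine le_of_pow_le_pow_left₀ three_ne_zero (by positivity) (le_of_mul_le_mul_right ?_ hα0)
    calc b ^ 3 * α ≤ (1 + b) ^ 3 * (α + b) := by gcongr <;> linarith
      _ ≤ 16 * M ^ (8 * j) := hup
      _ = 16 * (c ^ 3 * α) := by rw [hc3]
      _ ≤ 64 * (c ^ 3 * α) := by gcongr; norm_num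
      _ = (4 * c) ^ 3 * α := by ring
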